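/- Let I ⊆ R be a nonzero, proper S_n-invariant monomial ideal. If H̃_{i−1}(Γ^{μ,c}(I); k) ≠ 0 for some μ ∈ P_n and c ≤ p(μ), then there exists a maximal dual generator ρ ∈ Λ*_max(I) such that: (i) |c| + s(μ) − i ≤ n − ℓ(ρ); (ii) |μ| − (|c| + s(μ) − i) ≤ |ρ^+|; and (iii) μ ≤ ρ̃. -/

import Mathlib

open scoped BigOperators

noncomputable section
open Classical

/-! ## Generic (labeled) simplicial chain complexes and reduced homology over a field -/

section Homology

variable (K : Type) [Field K] {α : Type}

/-- Index type for chains: elements of `S` whose face (second component) has `j` elements. -/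
def ChainIdx (S : Set (α × Finset ℕ)) (j : ℕ) : Type :=
  {q : α × Finset ℕ // q ∈ S ∧ q.2.card = j}

/-- The boundary of a basis element, with the usual simplicial signs. -/
noncomputable def bdElt (S : Set (α × Finset ℕ)) (j : ℕ) (q : ChainIdx S (j + 1)) :
    ChainIdx S j →₀ K :=
  ∑ v ∈ q.1.2,
    if h : (q.1.1, q.1.2.erase v) ∈ S ∧ (q.1.2.erase v).card = j then
      ((-1 : K) ^ (q.1.2.filter (fun u => u ≤ v)).card) •
        Finsupp.single (⟨(q.1.1, q.1.2.erase v), h⟩ : ChainIdx S j) (1 : K)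
    else 0

/-- The simplicial boundary map. -/
noncomputable def bd (S : Set (α × Finset ℕ)) (j : ℕ) :
    (ChainIdx S (j + 1) →₀ K) →ₗ[K] (ChainIdx S j →₀ K) :=
  Finsupp.linearCombination K (bdElt K S j)

/-- Cycles in homological degree `j` (chains are indexed by the cardinality of faces;
degree `j` corresponds to reduced topological degree `j - 1`). -/
noncomputable def cycles (S : Set (α × Finset ℕ)) : (j : ℕ) → Submodule K (ChainIdx S j →₀ K)
  | 0 => ⊤
  | (i + 1) => LinearMap.ker (bd K S i)

/-- `rhd K S j` is the dimension of the reduced homology group `H̃_{j-1}` of the complex `S`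
(the chain groups being finite dimensional, this is `dim` cycles `- dim` boundaries). -/
noncomputable def rhd (S : Set (α × Finset ℕ)) (j : ℕ) : ℕ :=
  Module.finrank K (cycles K S j) -
    Module.finrank K (LinearMap.range (bd K S j) ⊓ cycles K S j : Submodule K _)

/-- `hdim K S j = dim_K H̃_j(S; K)`, for `j : ℤ` (zero for `j ≤ -2`). -/
noncomputable def hdim (S : Set (α × Finset ℕ)) (j : ℤ) : ℕ :=
  if 0 ≤ j + 1 then rhd K S (j + 1).toNat else 0

/-- View an unlabeled collection of faces as a labeled one (labels in `Unit`). -/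
def lab (Δ : Set (Finset ℕ)) : Set (Unit × Finset ℕ) := {q | q.2 ∈ Δ}

/-- Dimension of reduced homology `H̃_{j-1}(Δ; K)` of a collection `Δ` of finite sets. -/
noncomputable def rhd0 (Δ : Set (Finset ℕ)) (j : ℕ) : ℕ := rhd K (lab Δ) j

/-- Dimension of reduced homology `H̃_j(Δ; K)`, `j : ℤ`. -/
noncomputable def hdim0 (Δ : Set (Finset ℕ)) (j : ℤ) : ℕ := hdim K (lab Δ) j

end Homology

/-! ## Monomial ideals in `k[x_1, …, x_n]`, invariant under the symmetric group -/

section Poly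

variable (K : Type) [Field K] (n : ℕ)

/-- The monomial `x^a` in `k[x_1, …, x_n]`. -/
noncomputable def mon (a : Fin n → ℕ) : MvPolynomial (Fin n) K :=
  MvPolynomial.monomial (Finsupp.equivFunOnFinite.symm a) 1

/-- A monomial ideal: an ideal generated by a set of monomials. -/
def IsMonomialIdeal (I : Ideal (MvPolynomial (Fin n) K)) : Prop :=
  ∃ S : Set (Fin n → ℕ), I = Ideal.span (mon K n '' S)

/-- `I` is invariant under the action of `S_n` permuting the variables. -/
def IsSymmetricIdeal (I : Ideal (MvPolynomial (Fin n) K)) : Prop :=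
  ∀ σ : Equiv.Perm (Fin n), Ideal.map (MvPolynomial.rename σ).toRingHom I = I

end Poly

/-! ## Partitions given by blocks `(d_1^{p_1}, …, d_s^{p_s}, 0^{p_{s+1}})` -/

section Blocks

/-- `cumsum p k = p 0 + ⋯ + p (k-1)`. -/
def cumsum (p : ℕ → ℕ) (k : ℕ) : ℕ := ∑ j ∈ Finset.range k, p j

/-- The index of the block (among blocks `0, …, s`) containing position `i`,
for blocks of sizes `p 0, …, p (s-1)` followed by a final block. -/
def blkOf (p : ℕ → ℕ) (s i : ℕ) : ℕ :=
  ((Finset.range s).filter fun k => cumsum p (k + 1) ≤ i).card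

/-- The partition `μ = (d_0^{p_0}, …, d_{s-1}^{p_{s-1}}, 0^{p_s})` (0-indexed blocks),
as a function of the position `i ∈ {0, …, n-1}` where `n = cumsum p (s+1)`. -/
def muOf (s : ℕ) (d p : ℕ → ℕ) (i : ℕ) : ℕ :=
  if blkOf p s i < s then d (blkOf p s i) else 0

/-- The partition `μ ∖ c`, obtained from `μ` by replacing, for each `k`, the last `c k` of
the parts equal to `d k` by `d k - 1`. -/
def muMinus (s : ℕ) (d p c : ℕ → ℕ) (i : ℕ) : ℕ :=
  if blkOf p s i < s then
    (if p (blkOf p s i) - c (blkOf p s i) ≤ i - cumsum p (blkOf p s i) then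
      d (blkOf p s i) - 1 else d (blkOf p s i))
  else 0

/-- Indicator vector of a finite set `F`. -/
def eF (F : Finset ℕ) (j : ℕ) : ℕ := if j ∈ F then 1 else 0

end Blocks

/-! ## The simplicial complexes `Δ^{μ,c}(I)` and `Γ^{μ,c}(I)` -/

section Complexes

variable (K : Type) [Field K] (n : ℕ)

/-- The simplicial complex `Δ^{μ,c}(I) = {F ⊆ [s] : μ ∖ (c + e_F) ∈ P(I)}` (vertices are
`0, …, s-1`), for `μ = (d_0^{p_0}, …, d_{s-1}^{p_{s-1}}, 0^{p_s})` and `c ≤ p(μ)`. -/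
def DeltaCx (I : Ideal (MvPolynomial (Fin n) K)) (s : ℕ) (d p c : ℕ → ℕ) :
    Set (Finset ℕ) :=
  {F | F ⊆ Finset.range s ∧
    mon K n (fun i => muMinus s d p (fun j => c j + eF F j) i.val) ∈ I}

/-- The Alexander dual complex `Γ^{μ,c}(I) = {F ⊆ [s] : μ ∖ (c + e_{[s]∖F}) ∈ O(I)}`. -/
def GammaCx (I : Ideal (MvPolynomial (Fin n) K)) (s : ℕ) (d p c : ℕ → ℕ) :
    Set (Finset ℕ) :=
  {F | F ⊆ Finset.range s ∧
    mon K n (fun i => muMinus s d p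
      (fun j => c j + (if j < s ∧ j ∉ F then 1 else 0)) i.val) ∉ I}

/-- `γ_i^{μ,c}(I) = dim_K H̃_{i-1}(Δ^{μ,c}(I); K)`. -/
noncomputable def gammaDim (I : Ideal (MvPolynomial (Fin n) K)) (s : ℕ) (d p c : ℕ → ℕ)
    (i : ℕ) : ℕ :=
  rhd0 K (DeltaCx K n I s d p c) i

end Complexes

/-! ## Multigraded Tor via the Koszul complex

For a monomial ideal `I`, the multidegree-`a` strand of the Koszul complex `K_•(I)` is the
(shifted) reduced chain complex of the simplicial complex
`Δ_a^I = {F ⊆ [n] : a - e_F ≥ 0, x^{a - e_F} ∈ I}`, so that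
`dim_K Tor_i(I, K)_a = dim_K H̃_{i-1}(Δ_a^I; K)`, and similarly for `R/I` with the
condition `x^{a-e_F} ∉ I`. -/

section Tor

variable (K : Type) [Field K] (n : ℕ)

/-- The Koszul simplicial complex of the ideal `I` in multidegree `a`. -/
def KosI (I : Ideal (MvPolynomial (Fin n) K)) (a : Fin n → ℕ) : Set (Finset ℕ) :=
  {F | F ⊆ Finset.range n ∧ (∀ i : Fin n, (i : ℕ) ∈ F → 1 ≤ a i) ∧
    mon K n (fun i => a i - eF F i.val) ∈ I}

/-- The Koszul complex of `R/I` in multidegree `a`. -/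
def KosQ (I : Ideal (MvPolynomial (Fin n) K)) (a : Fin n → ℕ) : Set (Finset ℕ) :=
  {F | F ⊆ Finset.range n ∧ (∀ i : Fin n, (i : ℕ) ∈ F → 1 ≤ a i) ∧
    mon K n (fun i => a i - eF F i.val) ∉ I}

/-- `dim_K Tor_i(I, K)_a`, for a monomial ideal `I` and a multidegree `a ∈ ℤ^n`
(components with a negative coordinate vanish, so only `a ∈ ℕ^n` is needed). -/
noncomputable def torDim (I : Ideal (MvPolynomial (Fin n) K)) (i : ℕ) (a : Fin n → ℕ) : ℕ :=
  rhd0 K (KosI K n I a) i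

/-- `dim_K Tor_i(R/I, K)_a` for a monomial ideal `I`. -/
noncomputable def torQDim (I : Ideal (MvPolynomial (Fin n) K)) (i : ℕ) (a : Fin n → ℕ) : ℕ :=
  rhd0 K (KosQ K n I a) i

/-- `dim_K Tor_i(I, K)_{⟨μ⟩}`: the sum of `dim_K Tor_i(I, K)_a` over all rearrangements `a`
of the partition `μ`. -/
noncomputable def torDimSym (I : Ideal (MvPolynomial (Fin n) K)) (i : ℕ) (μ : Fin n → ℕ) : ℕ :=
  ∑ a ∈ Finset.image (fun σ : Equiv.Perm (Fin n) => μ ∘ σ) Finset.univ, torDim K n I i a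

/-- `dim_K Tor_i(R/I, K)_{⟨μ⟩}`. -/
noncomputable def torQDimSym (I : Ideal (MvPolynomial (Fin n) K)) (i : ℕ) (μ : Fin n → ℕ) : ℕ :=
  ∑ a ∈ Finset.image (fun σ : Equiv.Perm (Fin n) => μ ∘ σ) Finset.univ, torQDim K n I i a

end Tor

/-! ## Extended partitions in `P_n^∞` and the dual generators of an `S_n`-invariant
monomial ideal -/

section ExtendedPartitions

variable (K : Type) [Field K] (n : ℕ)

/-- `ℓ(μ)`: the number of entries of `μ ∈ P_n^∞` equal to `∞`. -/
def ellInf (μ : Fin n → ℕ∞) : ℕ := (Finset.univ.filter fun i => μ i = ⊤).card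

/-- The largest finite entry of `μ ∈ P_n^∞` (i.e. the first finite entry, `μ` being
weakly decreasing). -/
def topVal (μ : Fin n → ℕ∞) : ℕ := Finset.univ.sup fun i => (μ i).toNat

/-- `μ^+ ∈ P_n`: each `∞` entry of `μ` is replaced by (largest finite entry)` + 1`. -/
def plusOf (μ : Fin n → ℕ∞) (i : Fin n) : ℕ :=
  if μ i = ⊤ then topVal n μ + 1 else (μ i).toNat

/-- `μ̃ = μ^+ + (0^{ℓ(μ)}, 1^{n - ℓ(μ)}) ∈ P_n`. -/
def tildeOf (μ : Fin n → ℕ∞) (i : Fin n) : ℕ :=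
  if μ i = ⊤ then topVal n μ + 1 else (μ i).toNat + 1

/-- The ideal `Q_μ = ∩_{σ ∈ S_n} σ((x_k^{μ_k + 1}, …, x_n^{μ_n + 1}))`, where
`μ_k, …, μ_n` are the finite entries of `μ ∈ P_n^∞`. -/
noncomputable def Qgen (μ : Fin n → ℕ∞) : Ideal (MvPolynomial (Fin n) K) :=
  ⨅ σ : Equiv.Perm (Fin n),
    Ideal.map (MvPolynomial.rename σ).toRingHom
      (Ideal.span {g | ∃ i : Fin n, μ i ≠ ⊤ ∧ g = MvPolynomial.X i ^ ((μ i).toNat + 1)})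

/-- `Λ` is the (finite) set of dual generators of `I`, i.e. `I = ∩_{μ ∈ Λ} Q_μ` is the
irredundant presentation of `I` by ideals `Q_μ`. -/
def IsDualPresentation (I : Ideal (MvPolynomial (Fin n) K))
    (Λ : Finset (Fin n → ℕ∞)) : Prop :=
  (∀ μ ∈ Λ, Antitone μ) ∧ (I = ⨅ μ ∈ Λ, Qgen K n μ) ∧
    ∀ μ ∈ Λ, I ≠ ⨅ ρ ∈ Λ, ⨅ _ : ρ ≠ μ, Qgen K n ρ

/-- The partial order `≼` on dual generators: `μ ≼ ρ` iff `μ̃ ≤ ρ̃` (componentwise) and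
`ℓ(μ) - ℓ(ρ) ≤ |ρ̃| - |μ̃|`. -/
def preceq (μ ρ : Fin n → ℕ∞) : Prop :=
  (∀ i, tildeOf n μ i ≤ tildeOf n ρ i) ∧
    (∑ i, tildeOf n μ i) + ellInf n μ ≤ (∑ i, tildeOf n ρ i) + ellInf n ρ

/-- The extended partition `ρ = (∞^{p_0}, d_1^{p_1}, …, d_s^{p_s}) ∈ P_n^∞`
(so `n = p 0 + p 1 + ⋯ + p s`), as a function of the position `i ∈ {0, …, n-1}`. -/
def rhoOf (s : ℕ) (d p : ℕ → ℕ) (i : ℕ) : ℕ∞ :=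
  if blkOf p (s + 1) i = 0 then ⊤ else ((d (blkOf p (s + 1) i) : ℕ) : ℕ∞)

end ExtendedPartitions

section ConeVanishing

variable (K : Type) [Field K]

/-- The simplicial boundary map on chains of the full simplex on the vertex set `ℕ`. -/
def fullBd : (Finset ℕ →₀ K) →ₗ[K] (Finset ℕ →₀ K) :=
  Finsupp.linearCombination K fun F =>
    ∑ v ∈ F, ((-1 : K) ^ (F.filter (fun u => u ≤ v)).card) • Finsupp.single (F.erase v) (1 : K)

/-- Coning off chains from the vertex `0`. -/
def coneMap : (Finset ℕ →₀ K) →ₗ[K] (Finset ℕ →₀ K) :=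
  Finsupp.linearCombination K fun F =>
    if 0 ∈ F then 0 else Finsupp.single (insert 0 F) (1 : K)

theorem fullBd_single (F : Finset ℕ) : fullBd K (Finsupp.single F 1) =
    ∑ v ∈ F, ((-1 : K) ^ (F.filter (fun u => u ≤ v)).card) •
      Finsupp.single (F.erase v) (1 : K) := by
  simp [fullBd, Finsupp.linearCombination_single]

theorem coneMap_single (F : Finset ℕ) : coneMap K (Finsupp.single F 1) =
    if 0 ∈ F then 0 else Finsupp.single (insert 0 F) (1 : K) := by
  simp [coneMap, Finsupp.linearCombination_single]

theorem fullBd_coneMap_add_single (F : Finset ℕ) :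
    fullBd K (coneMap K (Finsupp.single F 1)) + coneMap K (fullBd K (Finsupp.single F 1)) =
      -Finsupp.single F 1 := by
  by_cases h0 : 0 ∈ F
  · rw [coneMap_single, if_pos h0, map_zero, zero_add, fullBd_single, map_sum,
      Finset.sum_eq_single_of_mem 0 h0]
    · have h1 : F.filter (fun u => u ≤ 0) = {0} := by
        ext u
        simp only [Finset.mem_filter, Finset.mem_singleton, nonpos_iff_eq_zero]
        exact ⟨fun h => h.2, fun h => ⟨h ▸ h0, h⟩⟩
      rw [h1, map_smul, coneMap_single, if_neg (Finset.notMem_erase 0 F),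
        Finset.insert_erase h0]
      simp
    · intro v _ hv
      rw [map_smul, coneMap_single, if_pos (Finset.mem_erase.2 ⟨hv.symm, h0⟩), smul_zero]
  · rw [coneMap_single, if_neg h0, fullBd_single, Finset.sum_insert h0, Finset.erase_insert h0,
      fullBd_single, map_sum]
    have h1 : (insert 0 F).filter (fun u => u ≤ 0) = {0} := by
      ext u
      simp only [Finset.mem_filter, Finset.mem_singleton, Finset.mem_insert, nonpos_iff_eq_zero]
      exact ⟨fun h => h.2, fun h => ⟨Or.inl h, h⟩⟩
    have h2 : ∀ v ∈ F, ((-1 : K) ^ ((insert 0 F).filter (fun u => u ≤ v)).card) •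
        Finsupp.single ((insert 0 F).erase v) (1 : K) =
        -coneMap K (((-1 : K) ^ (F.filter (fun u => u ≤ v)).card) •
          Finsupp.single (F.erase v) (1 : K)) := by
      intro v hv
      have hv0 : (0 : ℕ) ≠ v := fun h => h0 (h ▸ hv)
      rw [map_smul, coneMap_single, if_neg (fun h => h0 (Finset.mem_of_mem_erase h)),
        Finset.filter_insert, if_pos (Nat.zero_le v),
        Finset.card_insert_of_notMem (fun h => h0 (Finset.mem_filter.1 h).1),
        Finset.erase_insert_of_ne hv0, pow_succ]
      simp
    rw [Finset.sum_congr rfl h2, h1, Finset.sum_neg_distrib]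
    simp

theorem fullBd_coneMap_add (z : Finset ℕ →₀ K) :
    fullBd K (coneMap K z) + coneMap K (fullBd K z) = -z := by
  have h : (fullBd K).comp (coneMap K) + (coneMap K).comp (fullBd K) = -LinearMap.id := by
    refine Finsupp.lhom_ext' fun F => LinearMap.ext_ring ?_
    simpa using fullBd_coneMap_add_single K F
  simpa using LinearMap.congr_fun h z

/-- Chains of a complex, regarded as chains of the full simplex. -/
def chainIncl (Δ : Set (Finset ℕ)) (j : ℕ) :
    (ChainIdx (lab Δ) j →₀ K) →ₗ[K] (Finset ℕ →₀ K) :=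
  Finsupp.lmapDomain K K fun q => q.1.2

theorem chainIncl_single (Δ : Set (Finset ℕ)) (j : ℕ) (q : ChainIdx (lab Δ) j) (a : K) :
    chainIncl K Δ j (Finsupp.single q a) = Finsupp.single q.1.2 a :=
  Finsupp.mapDomain_single

theorem chainIncl_injective (Δ : Set (Finset ℕ)) (j : ℕ) :
    Function.Injective (chainIncl K Δ j) :=
  Finsupp.mapDomain_injective fun _ _ h => Subtype.ext (Prod.ext rfl h)

theorem chainIncl_bd {Δ : Set (Finset ℕ)} (hΔ : IsLowerSet Δ) (j : ℕ)
    (z : ChainIdx (lab Δ) (j + 1) →₀ K) :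
    chainIncl K Δ j (bd K (lab Δ) j z) = fullBd K (chainIncl K Δ (j + 1) z) := by
  have h : (chainIncl K Δ j).comp (bd K (lab Δ) j) =
      (fullBd K).comp (chainIncl K Δ (j + 1)) := by
    refine Finsupp.lhom_ext' fun q => LinearMap.ext_ring ?_
    simp only [LinearMap.comp_apply, Finsupp.lsingle_apply, chainIncl_single, fullBd_single,
      bd, Finsupp.linearCombination_single, one_smul, bdElt, map_sum]
    refine Finset.sum_congr rfl fun v hv => ?_
    have hmem : ((q.1.1, q.1.2.erase v) : Unit × Finset ℕ) ∈ lab Δ ∧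
        (q.1.2.erase v).card = j :=
      ⟨hΔ (Finset.erase_subset v q.1.2) q.2.1, by rw [Finset.card_erase_of_mem hv, q.2.2]; rfl⟩
    refine (congrArg (chainIncl K Δ j) (dif_pos hmem)).trans ?_
    exact ((chainIncl K Δ j).map_smul _ _).trans
      (congrArg _ (chainIncl_single K Δ j ⟨_, hmem⟩ 1))
  exact LinearMap.congr_fun h z

theorem fullBd_chainIncl_cycle {Δ : Set (Finset ℕ)} (hΔ : IsLowerSet Δ) (j : ℕ)
    {z : ChainIdx (lab Δ) j →₀ K} (hz : z ∈ cycles K (lab Δ) j) :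
    fullBd K (chainIncl K Δ j z) = 0 := by
  cases j with
  | zero =>
    have h : (fullBd K).comp (chainIncl K Δ 0) = 0 := by
      refine Finsupp.lhom_ext' fun q => LinearMap.ext_ring ?_
      simp only [LinearMap.comp_apply, Finsupp.lsingle_apply, chainIncl_single, fullBd_single,
        Finset.card_eq_zero.1 q.2.2, Finset.sum_empty, LinearMap.zero_apply]
    exact LinearMap.congr_fun h z
  | succ j =>
    have hz' : bd K (lab Δ) j z = 0 := hz
    rw [← chainIncl_bd K hΔ, hz', map_zero]

theorem coneMap_chainIncl_mem_range {Δ : Set (Finset ℕ)} {j : ℕ}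
    (hcone : ∀ F ∈ Δ, F.card = j → 0 ∉ F → insert 0 F ∈ Δ) (z : ChainIdx (lab Δ) j →₀ K) :
    coneMap K (chainIncl K Δ j z) ∈ LinearMap.range (chainIncl K Δ (j + 1)) := by
  induction z using Finsupp.induction_linear with
  | zero => simp
  | add f g hf hg => rw [map_add, map_add]; exact add_mem hf hg
  | single q a =>
    have ha : Finsupp.single q a = a • Finsupp.single q (1 : K) := by simp
    rw [ha, map_smul, map_smul, chainIncl_single, coneMap_single]
    refine Submodule.smul_mem _ _ ?_
    split_ifs with h0
    · exact zero_mem _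
    · exact ⟨Finsupp.single ⟨((), insert 0 q.1.2), hcone _ q.2.1 q.2.2 h0, by
        rw [Finset.card_insert_of_notMem h0, q.2.2]⟩ 1, chainIncl_single ..⟩

/-- If `H̃_{j-1}(Δ; K) ≠ 0`, some face of cardinality `j` cannot be extended by the vertex `0`. -/
theorem exists_face_insert_zero_notMem {Δ : Set (Finset ℕ)} (hΔ : IsLowerSet Δ) {j : ℕ}
    (hH : rhd0 K Δ j ≠ 0) : ∃ F ∈ Δ, F.card = j ∧ 0 ∉ F ∧ insert 0 F ∉ Δ := by
  by_contra! hcone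
  refine hH ?_
  have hle : cycles K (lab Δ) j ≤ LinearMap.range (bd K (lab Δ) j) := by
    intro z hz
    obtain ⟨w, hw⟩ := coneMap_chainIncl_mem_range K hcone z
    refine ⟨-w, chainIncl_injective K Δ j ?_⟩
    have h := fullBd_coneMap_add K (chainIncl K Δ j z)
    rw [fullBd_chainIncl_cycle K hΔ j hz, map_zero, add_zero, ← hw] at h
    rw [map_neg, map_neg, chainIncl_bd K hΔ, h, neg_neg]
  rw [rhd0, rhd, inf_eq_right.2 hle, Nat.sub_self]

end ConeVanishing

section Membership

variable (K : Type) [Field K] (n : ℕ)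

theorem mon_mem_of_le {I : Ideal (MvPolynomial (Fin n) K)} {a b : Fin n → ℕ} (hab : a ≤ b)
    (ha : mon K n a ∈ I) : mon K n b ∈ I := by
  refine I.mem_of_dvd ?_ ha
  rw [mon, mon, MvPolynomial.monomial_dvd_monomial]
  exact ⟨Or.inr fun t => hab t, dvd_rfl⟩

theorem mon_notMem_Qgen {ρ : Fin n → ℕ∞} {a : Fin n → ℕ} (h : ∀ t, (a t : ℕ∞) ≤ ρ t) :
    mon K n a ∉ Qgen K n ρ := by
  intro hmem
  have h1 := (Submodule.mem_iInf _).1 hmem 1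
  have h2 : (MvPolynomial.rename (R := K) (1 : Equiv.Perm (Fin n))).toRingHom =
      RingHom.id _ := by
    ext t <;> simp
  have h3 : {g : MvPolynomial (Fin n) K | ∃ i : Fin n, ρ i ≠ ⊤ ∧
      g = MvPolynomial.X i ^ ((ρ i).toNat + 1)} =
      (fun m => MvPolynomial.monomial m (1 : K)) ''
        {m | ∃ i : Fin n, ρ i ≠ ⊤ ∧ m = Finsupp.single i ((ρ i).toNat + 1)} := by
    ext g
    simp only [Set.mem_ofPred_eq, Set.mem_image, MvPolynomial.X_pow_eq_monomial]
    constructor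
    · rintro ⟨i, hi, rfl⟩
      exact ⟨_, ⟨i, hi, rfl⟩, rfl⟩
    · rintro ⟨_, ⟨i, hi, rfl⟩, rfl⟩
      exact ⟨i, hi, rfl⟩
  rw [h2, Ideal.map_id, h3, MvPolynomial.mem_ideal_span_monomial_image] at h1
  obtain ⟨_, ⟨i, hi, rfl⟩, hle⟩ := h1 (Finsupp.equivFunOnFinite.symm a) (by
    simp [mon, MvPolynomial.support_monomial])
  have h4 := hle i
  have h5 := h i
  rw [← ENat.natCast_toNat hi, Nat.cast_le] at h5
  simp at h4
  omega

theorem le_of_mon_notMem_Qgen {ρ : Fin n → ℕ∞} (hρ : Antitone ρ) {a : Fin n → ℕ}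
    (ha : Antitone a) (h : mon K n a ∉ Qgen K n ρ) (t : Fin n) : (a t : ℕ∞) ≤ ρ t := by
  by_contra! hlt
  refine h ((Submodule.mem_iInf _).2 fun σ => ?_)
  obtain ⟨m, htm, hmt⟩ : ∃ m, t ≤ m ∧ σ m ≤ t := by
    by_contra! hno
    have hsub : (Finset.Ici t).image σ ⊆ Finset.Ioi t := by
      intro x hx
      obtain ⟨m, hm, rfl⟩ := Finset.mem_image.1 hx
      exact Finset.mem_Ioi.2 (hno m (Finset.mem_Ici.1 hm))
    have hcard := Finset.card_le_card hsub
    rw [Finset.card_image_of_injective _ σ.injective, Fin.card_Ici, Fin.card_Ioi] at hcard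
    have := t.isLt
    omega
  have hm : ρ m < a (σ m) :=
    (hρ htm).trans_lt (hlt.trans_le (Nat.cast_le.2 (ha hmt)))
  have hm' : ρ m ≠ ⊤ := hm.ne_top
  have hgen : (MvPolynomial.X (σ m) : MvPolynomial (Fin n) K) ^ ((ρ m).toNat + 1) ∈
      Ideal.map (MvPolynomial.rename (R := K) σ).toRingHom
        (Ideal.span {g | ∃ i : Fin n, ρ i ≠ ⊤ ∧ g = MvPolynomial.X i ^ ((ρ i).toNat + 1)}) := by
    have hX : MvPolynomial.X m ^ ((ρ m).toNat + 1) ∈ {g : MvPolynomial (Fin n) K |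
        ∃ i : Fin n, ρ i ≠ ⊤ ∧ g = MvPolynomial.X i ^ ((ρ i).toNat + 1)} := ⟨m, hm', rfl⟩
    simpa using Ideal.mem_map_of_mem (MvPolynomial.rename (R := K) σ).toRingHom
      (Ideal.subset_span hX)
  refine Ideal.mem_of_dvd _ ?_ hgen
  rw [mon, MvPolynomial.X_pow_eq_monomial, MvPolynomial.monomial_dvd_monomial]
  refine ⟨Or.inr ?_, dvd_rfl⟩
  rw [Finsupp.single_le_iff]
  rw [← ENat.natCast_toNat hm', Nat.cast_lt] at hm
  exact hm

theorem Qgen_antitone {ρ ρ' : Fin n → ℕ∞} (h : ρ ≤ ρ') : Qgen K n ρ' ≤ Qgen K n ρ := by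
  refine iInf_mono fun σ => Ideal.map_mono (Ideal.span_le.2 ?_)
  rintro _ ⟨i, hi, rfl⟩
  have hi' : ρ i ≠ ⊤ := ne_top_of_le_ne_top hi (h i)
  exact Ideal.mem_of_dvd _ (pow_dvd_pow _ (Nat.succ_le_succ (ENat.toNat_le_toNat (h i) hi)))
    (Ideal.subset_span ⟨i, hi', rfl⟩)

variable {K n}

/-- The dual generators form an antichain. -/
theorem IsDualPresentation.eq_of_le {I : Ideal (MvPolynomial (Fin n) K)}
    {Λ : Finset (Fin n → ℕ∞)} (hΛ : IsDualPresentation K n I Λ) {ρ ρ' : Fin n → ℕ∞}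
    (hρ : ρ ∈ Λ) (hρ' : ρ' ∈ Λ) (h : ρ ≤ ρ') : ρ' = ρ := by
  by_contra hne
  refine hΛ.2.2 ρ hρ (hΛ.2.1.trans (le_antisymm ?_ ?_))
  · exact le_iInf₂ fun τ hτ => le_iInf fun _ => iInf₂_le τ hτ
  · refine le_iInf₂ fun τ hτ => ?_
    by_cases hτρ : τ = ρ
    · subst hτρ
      exact (iInf₂_le ρ' hρ').trans ((iInf_le _ hne).trans (Qgen_antitone K n h))
    · exact (iInf₂_le τ hτ).trans (iInf_le _ hτρ)

theorem IsDualPresentation.exists_le_of_mon_notMem {I : Ideal (MvPolynomial (Fin n) K)}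
    {Λ : Finset (Fin n → ℕ∞)} (hΛ : IsDualPresentation K n I Λ) {a : Fin n → ℕ}
    (ha : Antitone a) (h : mon K n a ∉ I) : ∃ ρ ∈ Λ, ∀ t, (a t : ℕ∞) ≤ ρ t := by
  rw [hΛ.2.1] at h
  simp only [Submodule.mem_iInf, not_forall] at h
  obtain ⟨ρ, hρ, hnot⟩ := h
  exact ⟨ρ, hρ, le_of_mon_notMem_Qgen K n (hΛ.1 ρ hρ) ha hnot⟩

theorem IsDualPresentation.mon_notMem {I : Ideal (MvPolynomial (Fin n) K)}
    {Λ : Finset (Fin n → ℕ∞)} (hΛ : IsDualPresentation K n I Λ) {ρ : Fin n → ℕ∞} (hρ : ρ ∈ Λ)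
    {a : Fin n → ℕ} (h : ∀ t, (a t : ℕ∞) ≤ ρ t) : mon K n a ∉ I := by
  rw [hΛ.2.1]
  exact fun hmem => mon_notMem_Qgen K n h ((iInf₂_le ρ hρ : _ ≤ Qgen K n ρ) hmem)

theorem lt_ellInf_iff {ρ : Fin n → ℕ∞} (hρ : Antitone ρ) (t : Fin n) :
    (t : ℕ) < ellInf n ρ ↔ ρ t = ⊤ := by
  constructor
  · intro h
    by_contra ht
    have hsub : (Finset.univ.filter fun i => ρ i = ⊤) ⊆ Finset.Iio t := by
      intro i hi
      refine Finset.mem_Iio.2 (lt_of_not_ge fun hle => ht ?_)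
      exact top_le_iff.1 ((Finset.mem_filter.1 hi).2 ▸ hρ hle)
    have := Finset.card_le_card hsub
    rw [Fin.card_Iio] at this
    exact absurd h (not_lt.2 this)
  · intro h
    have hsub : Finset.Iic t ⊆ Finset.univ.filter fun i => ρ i = ⊤ := by
      intro i hi
      exact Finset.mem_filter.2 ⟨Finset.mem_univ i, top_le_iff.1 (h ▸ hρ (Finset.mem_Iic.1 hi))⟩
    have := Finset.card_le_card hsub
    rw [Fin.card_Iic] at this
    exact this

theorem toNat_le_topVal (ρ : Fin n → ℕ∞) (t : Fin n) : (ρ t).toNat ≤ topVal n ρ :=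
  Finset.le_sup (f := fun i => (ρ i).toNat) (Finset.mem_univ t)

theorem le_of_tildeOf_le {ρ ρ' : Fin n → ℕ∞} (hρ : Antitone ρ) (hρ' : Antitone ρ')
    (h : ∀ t, tildeOf n ρ t ≤ tildeOf n ρ' t) (hell : ellInf n ρ ≤ ellInf n ρ') : ρ ≤ ρ' := by
  intro t
  by_cases ht' : ρ' t = ⊤
  · rw [ht']; exact le_top
  · have ht : ρ t ≠ ⊤ := fun ht =>
      ht' ((lt_ellInf_iff hρ' t).1 (((lt_ellInf_iff hρ t).2 ht).trans_le hell))
    have := h t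
    rw [tildeOf, tildeOf, if_neg ht, if_neg ht', Nat.add_le_add_iff_right] at this
    rw [← ENat.natCast_toNat ht, ← ENat.natCast_toNat ht', Nat.cast_le]
    exact this

/-- Distinct comparable dual generators have strictly decreasing `ℓ`. -/
theorem IsDualPresentation.ellInf_lt_of_preceq {I : Ideal (MvPolynomial (Fin n) K)}
    {Λ : Finset (Fin n → ℕ∞)} (hΛ : IsDualPresentation K n I Λ) {ρ ρ' : Fin n → ℕ∞}
    (hρ : ρ ∈ Λ) (hρ' : ρ' ∈ Λ) (h : preceq n ρ ρ') (hne : ρ' ≠ ρ) :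
    ellInf n ρ' < ellInf n ρ := by
  by_contra! hle
  exact hne (hΛ.eq_of_le hρ hρ' (le_of_tildeOf_le (hΛ.1 ρ hρ) (hΛ.1 ρ' hρ') h.1 hle))

theorem sum_plusOf_add (ρ : Fin n → ℕ∞) :
    ∑ t, plusOf n ρ t + n = ∑ t, tildeOf n ρ t + ellInf n ρ := by
  have h : ∀ t, plusOf n ρ t + 1 = tildeOf n ρ t + if ρ t = ⊤ then 1 else 0 := by
    intro t
    unfold plusOf tildeOf
    split_ifs <;> simp
  have hsum := Finset.sum_congr (rfl : (Finset.univ : Finset (Fin n)) = _) fun t _ => h t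
  rw [Finset.sum_add_distrib, Finset.sum_add_distrib, ← Finset.card_filter] at hsum
  simpa [ellInf] using hsum

end Membership

section BlockCounting

theorem cumsum_mono (p : ℕ → ℕ) : Monotone (cumsum p) := fun _ _ h =>
  Finset.sum_le_sum_of_subset (Finset.range_mono h)

theorem cumsum_succ (p : ℕ → ℕ) (k : ℕ) : cumsum p (k + 1) = cumsum p k + p k :=
  Finset.sum_range_succ p k

theorem blkOf_mono (p : ℕ → ℕ) (s : ℕ) : Monotone (blkOf p s) := fun _ _ h =>
  Finset.card_le_card (Finset.monotone_filter_right _ fun _ _ hk => hk.trans h)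

theorem blkOf_le (p : ℕ → ℕ) (s i : ℕ) : blkOf p s i ≤ s :=
  (Finset.card_filter_le _ _).trans (Finset.card_range s).le

theorem lt_cumsum_of_blkOf_lt {p : ℕ → ℕ} {s i : ℕ} (h : blkOf p s i < s) :
    i < cumsum p (blkOf p s i + 1) := by
  by_contra! hle
  have hsub : Finset.range (blkOf p s i + 1) ⊆
      (Finset.range s).filter fun k => cumsum p (k + 1) ≤ i := by
    intro k hk
    rw [Finset.mem_range] at hk
    exact Finset.mem_filter.2 ⟨Finset.mem_range.2 (by omega),
      (cumsum_mono p (by omega)).trans hle⟩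
  have := Finset.card_le_card hsub
  rw [Finset.card_range] at this
  exact absurd this (not_le.2 (Nat.lt_succ_self _))

theorem cumsum_blkOf_le (p : ℕ → ℕ) (s i : ℕ) : cumsum p (blkOf p s i) ≤ i := by
  by_contra! hlt
  have hpos : blkOf p s i ≠ 0 := by
    intro h0
    rw [h0] at hlt
    simp [cumsum] at hlt
  have hsub : ((Finset.range s).filter fun k => cumsum p (k + 1) ≤ i) ⊆
      Finset.range (blkOf p s i - 1) := by
    intro k hk
    have hk' := (Finset.mem_filter.1 hk).2
    refine Finset.mem_range.2 ?_
    by_contra! hle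
    have := cumsum_mono p (show blkOf p s i ≤ k + 1 by omega)
    omega
  have := Finset.card_le_card hsub
  rw [Finset.card_range] at this
  change blkOf p s i ≤ blkOf p s i - 1 at this
  omega

variable {s : ℕ} {d p : ℕ → ℕ}

theorem lt_of_lt_block (hd : ∀ k, k + 1 < s → d (k + 1) < d k) {j k : ℕ} (hjk : j < k)
    (hk : k < s) : d k < d j := by
  induction k, hjk using Nat.le_induction with
  | base => exact hd j hk
  | succ m _ ih => exact (hd m hk).trans (ih (by omega))

theorem muMinus_antitone (hd : ∀ k, k + 1 < s → d (k + 1) < d k) (c : ℕ → ℕ) :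
    Antitone (muMinus s d p c) := by
  intro i j hij
  have hb := blkOf_mono p s hij
  unfold muMinus
  by_cases hj : blkOf p s j < s
  · rw [if_pos hj, if_pos (hb.trans_lt hj)]
    rcases hb.lt_or_eq with hlt | heq
    · have := lt_of_lt_block hd hlt hj
      split_ifs <;> omega
    · rw [heq]
      split_ifs <;> omega
  · rw [if_neg hj]
    exact Nat.zero_le _

theorem muMinus_anti_right {c c' : ℕ → ℕ} (h : c ≤ c') :
    muMinus s d p c' ≤ muMinus s d p c := by
  intro i
  have : c (blkOf p s i) ≤ c' (blkOf p s i) := h (blkOf p s i)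
  change muMinus s d p c' i ≤ muMinus s d p c i
  unfold muMinus
  split_ifs <;> omega

theorem muOf_le_muMinus_add_one (c : ℕ → ℕ) (i : ℕ) :
    muOf s d p i ≤ muMinus s d p c i + 1 := by
  unfold muOf muMinus
  split_ifs <;> omega

theorem muMinus_le_muOf (c : ℕ → ℕ) (i : ℕ) : muMinus s d p c i ≤ muOf s d p i := by
  unfold muOf muMinus
  split_ifs <;> omega

theorem muOf_le_head (hd : ∀ k, k + 1 < s → d (k + 1) < d k) (i : ℕ) :
    muOf s d p i ≤ d 0 := by
  unfold muOf
  split_ifs with h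
  · rcases Nat.eq_zero_or_pos (blkOf p s i) with h0 | h0
    · rw [h0]
    · exact (lt_of_lt_block hd h0 h).le
  · exact Nat.zero_le _

/-- Passing from `μ` to `μ ∖ c` lowers the size by at most `|c|`. -/
theorem sum_muOf_le (n : ℕ) (c : ℕ → ℕ) :
    ∑ t : Fin n, muOf s d p t ≤ ∑ t : Fin n, muMinus s d p c t + ∑ k ∈ Finset.range s, c k := by
  set B : Finset (Fin n) := Finset.univ.filter fun t : Fin n => blkOf p s t < s ∧
    p (blkOf p s t) - c (blkOf p s t) ≤ (t : ℕ) - cumsum p (blkOf p s t) with hB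
  have hpt : ∀ t : Fin n, muOf s d p t ≤ muMinus s d p c t + if t ∈ B then 1 else 0 := by
    intro t
    by_cases ht : t ∈ B
    · rw [if_pos ht]
      exact muOf_le_muMinus_add_one c t
    · rw [if_neg ht]
      have ht' : ¬(blkOf p s t < s ∧
          p (blkOf p s t) - c (blkOf p s t) ≤ (t : ℕ) - cumsum p (blkOf p s t)) := by
        simpa [hB] using ht
      unfold muOf muMinus
      split_ifs <;> omega
  have hcard : B.card ≤ ∑ k ∈ Finset.range s, c k := by
    have hmaps : ∀ t ∈ B, blkOf p s t ∈ Finset.range s := fun t ht =>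
      Finset.mem_range.2 (Finset.mem_filter.1 ht).2.1
    rw [Finset.card_eq_sum_card_fiberwise hmaps]
    refine Finset.sum_le_sum fun k _ => ?_
    have hsub : (B.filter fun t : Fin n => blkOf p s t = k).image Fin.val ⊆
        Finset.Ico (cumsum p (k + 1) - c k) (cumsum p (k + 1)) := by
      intro x hx
      obtain ⟨t, ht, rfl⟩ := Finset.mem_image.1 hx
      obtain ⟨htB, rfl⟩ := Finset.mem_filter.1 ht
      obtain ⟨hlt, hle⟩ := (Finset.mem_filter.1 htB).2
      have h1 := lt_cumsum_of_blkOf_lt hlt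
      have h2 := cumsum_blkOf_le p s t
      have h3 := cumsum_succ p (blkOf p s t)
      exact Finset.mem_Ico.2 ⟨by omega, h1⟩
    have := Finset.card_le_card hsub
    rw [Finset.card_image_of_injective _ Fin.val_injective, Nat.card_Ico] at this
    omega
  calc ∑ t : Fin n, muOf s d p t
      ≤ ∑ t : Fin n, (muMinus s d p c t + if t ∈ B then 1 else 0) :=
        Finset.sum_le_sum fun t _ => hpt t
    _ = ∑ t : Fin n, muMinus s d p c t + B.card := by
        rw [Finset.sum_add_distrib]
        simp
    _ ≤ _ := Nat.add_le_add_left hcard _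

end BlockCounting

section Witness

variable {K : Type} [Field K] {n : ℕ} {I : Ideal (MvPolynomial (Fin n) K)} {s : ℕ}
  {d p c : ℕ → ℕ}

/-- The vector `c + e_{[s] ∖ F}`. -/
def addCompl (s : ℕ) (c : ℕ → ℕ) (F : Finset ℕ) (j : ℕ) : ℕ :=
  c j + if j < s ∧ j ∉ F then 1 else 0

theorem mem_GammaCx {F : Finset ℕ} : F ∈ GammaCx K n I s d p c ↔
    F ⊆ Finset.range s ∧ mon K n (fun t => muMinus s d p (addCompl s c F) t.val) ∉ I :=
  Iff.rfl

theorem addCompl_antitone (s : ℕ) (c : ℕ → ℕ) : Antitone (addCompl s c) := by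
  intro F G hFG j
  unfold addCompl
  by_cases hj : j ∈ F
  · simp [hj, hFG hj]
  · simp only [hj, not_false_eq_true, and_true]
    split_ifs <;> omega

theorem isLowerSet_GammaCx : IsLowerSet (GammaCx K n I s d p c) := by
  intro F G hGF hF
  rw [mem_GammaCx] at hF ⊢
  refine ⟨fun x hx => hF.1 (hGF hx), fun hG => hF.2 (mon_mem_of_le K n (fun t => ?_) hG)⟩
  exact muMinus_anti_right (addCompl_antitone s c hGF) t

theorem sum_addCompl {F : Finset ℕ} (hF : F ⊆ Finset.range s) :
    ∑ k ∈ Finset.range s, addCompl s c F k + F.card = ∑ k ∈ Finset.range s, c k + s := by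
  have h1 : ∑ k ∈ Finset.range s, (if k < s ∧ k ∉ F then 1 else 0) =
      (Finset.range s \ F).card := by
    rw [← Finset.card_filter]
    congr 1
    ext k
    simp
  have h2 := Finset.card_sdiff_add_card_eq_card hF
  rw [Finset.card_range] at h2
  unfold addCompl
  rw [Finset.sum_add_distrib, h1]
  omega

theorem muMinus_addCompl_insert_zero {F : Finset ℕ} {t : ℕ}
    (hlt : muMinus s d p (addCompl s c F) t < muMinus s d p (addCompl s c (insert 0 F)) t) :
    p 0 = t + c 0 + 1 ∧ d 0 ≤ muMinus s d p (addCompl s c F) t + 1 := by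
  have h0 : blkOf p s t = 0 := by
    by_contra hne
    have : addCompl s c (insert 0 F) (blkOf p s t) = addCompl s c F (blkOf p s t) := by
      simp [addCompl, hne]
    unfold muMinus at hlt
    rw [this] at hlt
    exact lt_irrefl _ hlt
  have hc : cumsum p 0 = 0 := rfl
  have h1 : addCompl s c (insert 0 F) 0 = c 0 := by simp [addCompl]
  have h2 : addCompl s c F 0 ≤ c 0 + 1 := by unfold addCompl; split_ifs <;> omega
  unfold muMinus at hlt ⊢
  rw [h0, hc] at hlt ⊢
  rw [h1] at hlt
  split_ifs at hlt ⊢ <;> omega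

/-- A face of `Γ^{μ,c}(I)` of cardinality `i` avoiding the first vertex and not extendable by it
produces a dual generator satisfying the three bounds. -/
theorem exists_dualGenerator_of_face {Λ : Finset (Fin n → ℕ∞)}
    (hpres : IsDualPresentation K n I Λ) (hn : n = cumsum p (s + 1))
    (hd : ∀ k, k + 1 < s → d (k + 1) < d k) (hc : ∀ k, k < s → c k + 1 ≤ p k)
    {F : Finset ℕ} (hF : F ∈ GammaCx K n I s d p c)
    (hF0 : insert 0 F ∉ GammaCx K n I s d p c) :
    ∃ ρ ∈ Λ, ∑ k ∈ Finset.range s, c k + s + ellInf n ρ ≤ n + F.card ∧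
      ∑ t : Fin n, muOf s d p t + F.card ≤
        ∑ t, plusOf n ρ t + (∑ k ∈ Finset.range s, c k + s) ∧
      ∀ t : Fin n, muOf s d p t ≤ tildeOf n ρ t := by
  rw [mem_GammaCx] at hF hF0
  obtain ⟨ρ, hρ, hle⟩ := hpres.exists_le_of_mon_notMem
    (fun _ _ h => muMinus_antitone hd _ (Fin.le_def.1 h)) hF.2
  have hρanti := hpres.1 ρ hρ
  have hfin : ∀ t, ρ t ≠ ⊤ → muMinus s d p (addCompl s c F) t ≤ (ρ t).toNat := fun t ht => by
    have := hle t
    rwa [← ENat.natCast_toNat ht, Nat.cast_le] at this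
  obtain ⟨hell, htop⟩ : ∑ k ∈ Finset.range s, c k + s + ellInf n ρ ≤ n + F.card ∧
      ∀ t : Fin n, ρ t = ⊤ → muOf s d p t ≤ topVal n ρ + 1 := by
    rcases Nat.eq_zero_or_pos s with rfl | hs
    · refine ⟨?_, fun t _ => by simp [muOf]⟩
      have : ellInf n ρ ≤ n := (Finset.card_filter_le _ _).trans (by simp)
      simp only [Finset.range_zero, Finset.sum_empty]
      omega
    · have hsub : insert 0 F ⊆ Finset.range s :=
        Finset.insert_subset (Finset.mem_range.2 hs) hF.1
      have hnot : ¬∀ t : Fin n, (muMinus s d p (addCompl s c (insert 0 F)) t : ℕ∞) ≤ ρ t :=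
        fun h => hF0 ⟨hsub, hpres.mon_notMem hρ h⟩
      push Not at hnot
      obtain ⟨t, ht⟩ := hnot
      obtain ⟨hp0, hd0⟩ := muMinus_addCompl_insert_zero
        (Nat.cast_lt.1 ((hle t).trans_lt ht))
      have htfin : ρ t ≠ ⊤ := ht.ne_top
      constructor
      · have h1 : ellInf n ρ ≤ t := by
          by_contra! hlt
          exact htfin ((lt_ellInf_iff hρanti t).1 hlt)
        obtain ⟨m, rfl⟩ : ∃ m, s = m + 1 := ⟨s - 1, by omega⟩
        have h2 : ∑ k ∈ Finset.range m, (c (k + 1) + 1) ≤ ∑ k ∈ Finset.range m, p (k + 1) :=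
          Finset.sum_le_sum fun k hk => hc (k + 1) (by simpa using hk)
        rw [Finset.sum_add_distrib] at h2
        simp only [Finset.sum_const, Finset.card_range, smul_eq_mul, mul_one] at h2
        rw [cumsum_succ, cumsum, Finset.sum_range_succ'] at hn
        rw [Finset.sum_range_succ']
        omega
      · intro t' _
        have h1 := muOf_le_head (p := p) hd t'
        have h2 := hfin t htfin
        have h3 := toNat_le_topVal ρ t
        omega
  refine ⟨ρ, hρ, hell, ?_, fun t => ?_⟩
  · have h1 := sum_muOf_le (s := s) (d := d) (p := p) n (addCompl s c F)
    have h2 := sum_addCompl (c := c) hF.1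
    have h3 : ∑ t : Fin n, muMinus s d p (addCompl s c F) t ≤ ∑ t, plusOf n ρ t := by
      refine Finset.sum_le_sum fun t _ => ?_
      unfold plusOf
      split_ifs with ht
      · exact (muMinus_le_muOf _ _).trans (htop t ht)
      · exact hfin t ht
    omega
  · unfold tildeOf
    split_ifs with ht
    · exact htop t ht
    · exact (muOf_le_muMinus_add_one _ _).trans (Nat.add_le_add_right (hfin t ht) 1)

end Witness

/-- Let `I` be a nonzero, proper `S_n`-invariant monomial ideal.  If
`H̃_{i-1}(Γ^{μ,c}(I); k) ≠ 0` for some `μ = (d_1^{p_1}, …, d_s^{p_s}, 0^{p_{s+1}}) ∈ P_n`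
and `c ≤ p(μ)`, then there is a maximal dual generator `ρ ∈ Λ*_max(I)` with
(i) `|c| + s(μ) - i ≤ n - ℓ(ρ)`, (ii) `|μ| - (|c| + s(μ) - i) ≤ |ρ^+|`, and
(iii) `μ ≤ ρ̃`. -/
theorem statement_12 (K : Type) [Field K] (n : ℕ) (I : Ideal (MvPolynomial (Fin n) K))
    (hmon : IsMonomialIdeal K n I) (hsym : IsSymmetricIdeal K n I)
    (hne : I ≠ ⊥) (hproper : I ≠ ⊤)
    (Λ : Finset (Fin n → ℕ∞)) (hpres : IsDualPresentation K n I Λ)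
    (s : ℕ) (d p : ℕ → ℕ)
    (hn : n = cumsum p (s + 1))
    (hd : ∀ k, k + 1 < s → d (k + 1) < d k)
    (hdpos : ∀ k, k < s → 0 < d k)
    (hppos : ∀ k, k < s → 0 < p k)
    (c : ℕ → ℕ) (hc : ∀ k, k < s → c k + 1 ≤ p k)
    (i : ℕ)
    (hH : hdim0 K (GammaCx K n I s d p c) ((i : ℤ) - 1) ≠ 0) :
    ∃ ρ ∈ Λ, (∀ μ ∈ Λ, preceq n ρ μ → μ = ρ) ∧
      ((∑ k ∈ Finset.range s, (c k : ℤ)) + s - i ≤ (n : ℤ) - ellInf n ρ) ∧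
      ((∑ t : Fin n, (muOf s d p t.val : ℤ)) - ((∑ k ∈ Finset.range s, (c k : ℤ)) + s - i)
          ≤ ∑ t : Fin n, (plusOf n ρ t : ℤ)) ∧
      (∀ t : Fin n, muOf s d p t.val ≤ tildeOf n ρ t) := by
  have hH' : rhd0 K (GammaCx K n I s d p c) i ≠ 0 := by
    simpa [hdim0, hdim, rhd0] using hH
  obtain ⟨F, hF, rfl, -, hF0⟩ :=
    exists_face_insert_zero_notMem K isLowerSet_GammaCx hH'
  let T : Finset (Fin n → ℕ∞) := Λ.filter fun ρ =>
    ∑ k ∈ Finset.range s, c k + s + ellInf n ρ ≤ n + F.card ∧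
      ∑ t : Fin n, muOf s d p t + F.card ≤
        ∑ t, plusOf n ρ t + (∑ k ∈ Finset.range s, c k + s) ∧
      ∀ t : Fin n, muOf s d p t ≤ tildeOf n ρ t
  have hT : T.Nonempty := by
    obtain ⟨ρ, hρ, h⟩ := exists_dualGenerator_of_face hpres hn hd hc hF hF0
    exact ⟨ρ, Finset.mem_filter.2 ⟨hρ, h⟩⟩
  obtain ⟨ρ, hρT, hmin⟩ := T.exists_min_image (ellInf n) hT
  obtain ⟨hρ, h1, h2, h3⟩ := Finset.mem_filter.1 hρT
  refine ⟨ρ, hρ, fun τ hτ hle => ?_, ?_, ?_, h3⟩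
  · by_contra hne'
    have hlt := hpres.ellInf_lt_of_preceq hρ hτ hle hne'
    have hplus := sum_plusOf_add ρ
    have hplus' := sum_plusOf_add τ
    have hsum := hle.2
    refine absurd (hmin τ (Finset.mem_filter.2 ⟨hτ, ?_, ?_, fun t => (h3 t).trans (hle.1 t)⟩))
      (not_le.2 hlt)
    · omega
    · omega
  · zify at h1
    linarith
  · zify at h2
    linarith
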